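/- The algebra U_{r,s}(so_{2n+1}) is a Hopf algebra, with comultiplication, counit and antipode determined on generators by Δ(ω_i^{±1}) = ω_i^{±1} ⊗ ω_i^{±1}, Δ(ω_i'^{±1}) = ω_i'^{±1} ⊗ ω_i'^{±1}, Δ(e_i) = e_i ⊗ 1 + ω_i ⊗ e_i, Δ(f_i) = 1 ⊗ f_i + f_i ⊗ ω_i', ε(ω_i^{±1}) = ε(ω_i'^{±1}) = 1, ε(e_i) = ε(f_i) = 0, S(ω_i^{±1}) = ω_i^{∓1}, S(ω_i'^{±1}) = ω_i'^{∓1}, S(e_i) = −ω_i^{-1}e_i, S(f_i) = −f_i ω_i'^{-1}; i.e., these assignments extend to well-defined algebra homomorphisms Δ : U → U ⊗ U and ε : U → K and an algebra antihomomorphism S : U → U satisfying the coassociativity, counit and antipode axioms of a Hopf algebra. -/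

import Mathlib

/-!
STATEMENT 0.  The two-parameter quantum group U = U_{r,s}(so_{2n+1}) (type Bₙ; here
the rank is n+1 for a parameter n : ℕ, and all indices are 0-based, the last simple
root being α_n = ε_n) is a Hopf algebra, with comultiplication, counit and antipode
determined on generators by
Δ(ω_i^{±1}) = ω_i^{±1} ⊗ ω_i^{±1}, Δ(ω_i'^{±1}) = ω_i'^{±1} ⊗ ω_i'^{±1},
Δ(e_i) = e_i ⊗ 1 + ω_i ⊗ e_i, Δ(f_i) = 1 ⊗ f_i + f_i ⊗ ω_i',
ε(ω_i^{±1}) = ε(ω_i'^{±1}) = 1, ε(e_i) = ε(f_i) = 0,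
S(ω_i^{±1}) = ω_i^{∓1}, S(ω_i'^{±1}) = ω_i'^{∓1}, S(e_i) = −ω_i⁻¹e_i,
S(f_i) = −f_iω_i'⁻¹, satisfying the coassociativity, counit and antipode axioms.
-/

noncomputable section
open scoped TensorProduct

/-- K = ℚ(r,s) -/
abbrev KK : Type := FractionRing (MvPolynomial (Fin 2) ℚ)
def qr : KK := algebraMap (MvPolynomial (Fin 2) ℚ) KK (MvPolynomial.X 0)
def qs : KK := algebraMap (MvPolynomial (Fin 2) ℚ) KK (MvPolynomial.X 1)

/-- generators e_i, f_i, ω_i^{±1}, ω_i'^{±1} -/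
inductive Gen (N : ℕ)
  | e (i : Fin N) | f (i : Fin N)
  | w (i : Fin N) | winv (i : Fin N) | wp (i : Fin N) | wpinv (i : Fin N)

def Gen.toral {N : ℕ} : Gen N → Prop
  | .e _ => False
  | .f _ => False
  | _ => True

/-- (ε_j, α_i) for type Bₙ of rank n+1 (0-indexed; α_i = ε_i − ε_{i+1} for i < n,
α_n = ε_n). -/
def ipaB (n : ℕ) (j i : ℕ) : ℤ :=
  if i < n then (if j = i then 1 else 0) - (if j = i+1 then 1 else 0)
  else (if j = n then 1 else 0)

/-- r_i = r^{(α_i,α_i)} : r_i = ρ² for i < n and r_n = ρ. -/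
def riB (n : ℕ) (ρ : KK) (i : ℕ) : KK := if i < n then ρ^2 else ρ

abbrev FB (n : ℕ) : Type := FreeAlgebra KK (Gen (n+1))
abbrev XB {n : ℕ} : Gen (n+1) → FB n := FreeAlgebra.ι KK

/-- The defining relations (B1)–(B7) of U_{r,s}(so_{2(n+1)+1}). -/
inductive RelB (n : ℕ) : FB n → FB n → Prop
  -- (B1)
  | comm (g g' : Gen (n+1)) (hg : g.toral) (hg' : g'.toral) :
      RelB n (XB g * XB g') (XB g' * XB g)
  | winv_r (i : Fin (n+1)) : RelB n (XB (.w i) * XB (.winv i)) 1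
  | winv_l (i : Fin (n+1)) : RelB n (XB (.winv i) * XB (.w i)) 1
  | wpinv_r (i : Fin (n+1)) : RelB n (XB (.wp i) * XB (.wpinv i)) 1
  | wpinv_l (i : Fin (n+1)) : RelB n (XB (.wpinv i) * XB (.wp i)) 1
  -- (B2)
  | b2we (i j : Fin (n+1)) (hj : (j:ℕ) < n) :
      RelB n (XB (.w j) * XB (.e i) * XB (.winv j))
        (((riB n qr j)^(ipaB n j i) * (riB n qs j)^(ipaB n ((j:ℕ)+1) i)) • XB (.e i))
  | b2wf (i j : Fin (n+1)) (hj : (j:ℕ) < n) :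
      RelB n (XB (.w j) * XB (.f i) * XB (.winv j))
        (((riB n qr j)^(-(ipaB n j i)) * (riB n qs j)^(-(ipaB n ((j:ℕ)+1) i))) • XB (.f i))
  | b2wne (j : Fin (n+1)) (hj : (j:ℕ) < n) :
      RelB n (XB (.w (Fin.last n)) * XB (.e j) * XB (.winv (Fin.last n)))
        ((riB n qr n)^(2 * ipaB n n j) • XB (.e j))
  | b2wnf (j : Fin (n+1)) (hj : (j:ℕ) < n) :
      RelB n (XB (.w (Fin.last n)) * XB (.f j) * XB (.winv (Fin.last n)))
        ((riB n qr n)^(-(2 * ipaB n n j)) • XB (.f j))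
  | b2wnen :
      RelB n (XB (.w (Fin.last n)) * XB (.e (Fin.last n)) * XB (.winv (Fin.last n)))
        ((riB n qr n * (riB n qs n)⁻¹) • XB (.e (Fin.last n)))
  | b2wnfn :
      RelB n (XB (.w (Fin.last n)) * XB (.f (Fin.last n)) * XB (.winv (Fin.last n)))
        (((riB n qr n)⁻¹ * riB n qs n) • XB (.f (Fin.last n)))
  -- (B3)
  | b3wpe (i j : Fin (n+1)) (hj : (j:ℕ) < n) :
      RelB n (XB (.wp j) * XB (.e i) * XB (.wpinv j))
        (((riB n qs j)^(ipaB n j i) * (riB n qr j)^(ipaB n ((j:ℕ)+1) i)) • XB (.e i))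
  | b3wpf (i j : Fin (n+1)) (hj : (j:ℕ) < n) :
      RelB n (XB (.wp j) * XB (.f i) * XB (.wpinv j))
        (((riB n qs j)^(-(ipaB n j i)) * (riB n qr j)^(-(ipaB n ((j:ℕ)+1) i))) • XB (.f i))
  | b3wpne (j : Fin (n+1)) (hj : (j:ℕ) < n) :
      RelB n (XB (.wp (Fin.last n)) * XB (.e j) * XB (.wpinv (Fin.last n)))
        ((riB n qs n)^(2 * ipaB n n j) • XB (.e j))
  | b3wpnf (j : Fin (n+1)) (hj : (j:ℕ) < n) :
      RelB n (XB (.wp (Fin.last n)) * XB (.f j) * XB (.wpinv (Fin.last n)))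
        ((riB n qs n)^(-(2 * ipaB n n j)) • XB (.f j))
  | b3wpnen :
      RelB n (XB (.wp (Fin.last n)) * XB (.e (Fin.last n)) * XB (.wpinv (Fin.last n)))
        ((riB n qs n * (riB n qr n)⁻¹) • XB (.e (Fin.last n)))
  | b3wpnfn :
      RelB n (XB (.wp (Fin.last n)) * XB (.f (Fin.last n)) * XB (.wpinv (Fin.last n)))
        (((riB n qs n)⁻¹ * riB n qr n) • XB (.f (Fin.last n)))
  -- (B4)
  | b4 (i j : Fin (n+1)) :
      RelB n (XB (.e i) * XB (.f j) - XB (.f j) * XB (.e i))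
        (if i = j then (riB n qr i - riB n qs i)⁻¹ • (XB (.w i) - XB (.wp i)) else 0)
  -- (B5)
  | b5e (i j : Fin (n+1)) (h : (i:ℕ)+1 < j ∨ (j:ℕ)+1 < i) :
      RelB n (XB (.e i) * XB (.e j) - XB (.e j) * XB (.e i)) 0
  | b5f (i j : Fin (n+1)) (h : (i:ℕ)+1 < j ∨ (j:ℕ)+1 < i) :
      RelB n (XB (.f i) * XB (.f j) - XB (.f j) * XB (.f i)) 0
  -- (B6)
  | b6a (i j : Fin (n+1)) (hij : (j:ℕ) = (i:ℕ)+1) (h : (i:ℕ) < n) :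
      RelB n (XB (.e i)^2 * XB (.e j)
        - (riB n qr i + riB n qs i) • (XB (.e i) * XB (.e j) * XB (.e i))
        + (riB n qr i * riB n qs i) • (XB (.e j) * XB (.e i)^2)) 0
  | b6b (i j : Fin (n+1)) (hij : (j:ℕ) = (i:ℕ)+1) (h : (i:ℕ)+1 < n) :
      RelB n (XB (.e j)^2 * XB (.e i)
        - ((riB n qr ((i:ℕ)+1))⁻¹ + (riB n qs ((i:ℕ)+1))⁻¹) • (XB (.e j) * XB (.e i) * XB (.e j))
        + (riB n qr ((i:ℕ)+1) * riB n qs ((i:ℕ)+1))⁻¹ • (XB (.e i) * XB (.e j)^2)) 0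
  | b6c (i : Fin (n+1)) (h : (i:ℕ)+1 = n) :
      RelB n (XB (.e (Fin.last n))^3 * XB (.e i)
        - (qr^(-2:ℤ) + qr⁻¹*qs⁻¹ + qs^(-2:ℤ)) • (XB (.e (Fin.last n))^2 * XB (.e i) * XB (.e (Fin.last n)))
        + ((qr*qs)⁻¹ * (qr^(-2:ℤ) + qr⁻¹*qs⁻¹ + qs^(-2:ℤ))) • (XB (.e (Fin.last n)) * XB (.e i) * XB (.e (Fin.last n))^2)
        - (qr*qs)^(-3:ℤ) • (XB (.e i) * XB (.e (Fin.last n))^3)) 0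
  -- (B7)
  | b7a (i j : Fin (n+1)) (hij : (j:ℕ) = (i:ℕ)+1) (h : (i:ℕ) < n) :
      RelB n (XB (.f j) * XB (.f i)^2
        - (riB n qr i + riB n qs i) • (XB (.f i) * XB (.f j) * XB (.f i))
        + (riB n qr i * riB n qs i) • (XB (.f i)^2 * XB (.f j))) 0
  | b7b (i j : Fin (n+1)) (hij : (j:ℕ) = (i:ℕ)+1) (h : (i:ℕ)+1 < n) :
      RelB n (XB (.f i) * XB (.f j)^2
        - ((riB n qr ((i:ℕ)+1))⁻¹ + (riB n qs ((i:ℕ)+1))⁻¹) • (XB (.f j) * XB (.f i) * XB (.f j))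
        + (riB n qr ((i:ℕ)+1) * riB n qs ((i:ℕ)+1))⁻¹ • (XB (.f j)^2 * XB (.f i))) 0
  | b7c (i : Fin (n+1)) (h : (i:ℕ)+1 = n) :
      RelB n (XB (.f i) * XB (.f (Fin.last n))^3
        - (qr^(-2:ℤ) + qr⁻¹*qs⁻¹ + qs^(-2:ℤ)) • (XB (.f (Fin.last n)) * XB (.f i) * XB (.f (Fin.last n))^2)
        + ((qr*qs)⁻¹ * (qr^(-2:ℤ) + qr⁻¹*qs⁻¹ + qs^(-2:ℤ))) • (XB (.f (Fin.last n))^2 * XB (.f i) * XB (.f (Fin.last n)))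
        - (qr*qs)^(-3:ℤ) • (XB (.f (Fin.last n))^3 * XB (.f i))) 0

/-- U_{r,s}(so_{2(n+1)+1}) -/
abbrev UB (n : ℕ) : Type := RingQuot (RelB n)

def genB (n : ℕ) (g : Gen (n+1)) : UB n := RingQuot.mkAlgHom KK (RelB n) (XB g)

section QuantumDouble

variable {K A B : Type*} [Field K] [Ring A] [Algebra K A] [Ring B] [Algebra K B]

/-- The iterated braided adjoint action of `x` on `y`, with braiding scalars `q` (of `x` with
itself) and `p` (of `x` with `y`); its vanishing is a quantum Serre relation. -/
def qSerre (q p : K) (x y : A) : ℕ → A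
  | 0 => y
  | k + 1 => x * qSerre q p x y k - (q ^ k * p) • (qSerre q p x y k * x)

theorem map_qSerre (f : A →ₐ[K] B) (q p : K) (x y : A) (m : ℕ) :
    f (qSerre q p x y m) = qSerre q p (f x) (f y) m := by
  induction m with
  | zero => rfl
  | succ k ih => simp [qSerre, ih]

theorem qSerre_zero_zero (q p : K) (m : ℕ) : qSerre q p (0 : A) 0 m = 0 := by
  induction m with
  | zero => rfl
  | succ k ih => simp [qSerre]

theorem qSerre_smul (q p c d : K) (x y : A) (m : ℕ) :
    qSerre q p (c • x) (d • y) m = (c ^ m * d) • qSerre q p x y m := by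
  induction m with
  | zero => simp [qSerre]
  | succ k ih =>
    simp only [qSerre, ih, smul_mul_smul_comm, smul_sub, smul_smul]
    congr 2 <;> ring

theorem qSerre_mul_of_commute (q p : K) {u v x y : A} (huv : Commute u v) (hux : Commute u x)
    (huy : Commute u y) (hvx : Commute v x) (m : ℕ) :
    qSerre q p (u * x) (v * y) m = u ^ m * v * qSerre q p x y m := by
  have hus (k) : Commute u (qSerre q p x y k) := by
    induction k with
    | zero => exact huy
    | succ k ih => exact (hux.mul_right ih).sub_right ((ih.mul_right hux).smul_right _)
  induction m with
  | zero => simp [qSerre]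
  | succ k ih =>
    have h1 : u * x * (u ^ k * v * qSerre q p x y k)
        = u ^ (k + 1) * v * (x * qSerre q p x y k) := by
      have : Commute x (u ^ k * v) := (hux.symm.pow_right k).mul_right hvx.symm
      rw [mul_assoc u x, ← mul_assoc x, this.eq, pow_succ']
      simp only [mul_assoc]
    have h2 : u ^ k * v * qSerre q p x y k * (u * x)
        = u ^ (k + 1) * v * (qSerre q p x y k * x) := by
      rw [← mul_assoc, mul_assoc (u ^ k * v), ← (hus k).eq, mul_assoc (u ^ k) v, ← mul_assoc v u,
        ← huv.eq, pow_succ]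
      simp only [mul_assoc]
    rw [qSerre, ih, h1, h2, qSerre, mul_sub, mul_smul_comm]

theorem qSerre_add {q p p' : K} {x x' y y' : A} {m : ℕ} (hm : 1 ≤ m ∧ m ≤ 3)
    (hxx : x' * x = q • (x * x')) (hxy : x' * y = p • (y * x'))
    (hyx : y' * x = p' • (x * y')) (hp : p * p' * q ^ (m - 1) = 1) :
    qSerre q p (x + x') (y + y') m = qSerre q p x y m + qSerre q p x' y' m := by
  have hxx' (z : A) : x' * (x * z) = q • (x * (x' * z)) := by
    rw [← mul_assoc, hxx, smul_mul_assoc, mul_assoc]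
  have hxy' (z : A) : x' * (y * z) = p • (y * (x' * z)) := by
    rw [← mul_assoc, hxy, smul_mul_assoc, mul_assoc]
  have hyx' (z : A) : y' * (x * z) = p' • (x * (y' * z)) := by
    rw [← mul_assoc, hyx, smul_mul_assoc, mul_assoc]
  obtain ⟨h1, h3⟩ := hm
  interval_cases m <;>
  simp only [qSerre, mul_add, add_mul, mul_sub, sub_mul, mul_assoc, hxx, hxx', hxy, hxy', hyx,
    hyx', mul_smul_comm, smul_mul_assoc, smul_smul, smul_add, smul_sub] <;>
  match_scalars <;> simp at hp ⊢ <;> grind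

set_option linter.unusedSimpArgs false in
/-- The quantum Serre relation is stable under the antipode. -/
theorem qSerre_op_eq_zero {q p p' : K} {u v x y : A} {m : ℕ} (hm : 1 ≤ m ∧ m ≤ 3)
    (huv : u * v = v * u) (hxu : x * u = q • (u * x)) (hyu : y * u = p • (u * y))
    (hxv : x * v = p' • (v * x)) (hp : p * p' * q ^ (m - 1) = 1)
    (h : qSerre q p x y m = 0) :
    qSerre q p (MulOpposite.op (u * x)) (MulOpposite.op (v * y)) m = 0 := by
  have hxu' (z : A) : x * (u * z) = q • (u * (x * z)) := by
    rw [← mul_assoc, hxu, smul_mul_assoc, mul_assoc]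
  have hyu' (z : A) : y * (u * z) = p • (u * (y * z)) := by
    rw [← mul_assoc, hyu, smul_mul_assoc, mul_assoc]
  have hxv' (z : A) : x * (v * z) = p' • (v * (x * z)) := by
    rw [← mul_assoc, hxv, smul_mul_assoc, mul_assoc]
  have huv' (z : A) : u * (v * z) = v * (u * z) := by
    rw [← mul_assoc, huv, mul_assoc]
  apply MulOpposite.unop_injective
  trans (-1 : K) ^ m • (v * (u ^ m * qSerre q p x y m))
  · clear h
    obtain ⟨h1, h3⟩ := hm
    interval_cases m <;>
    simp only [qSerre, MulOpposite.unop_sub, MulOpposite.unop_mul, MulOpposite.unop_smul,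
      MulOpposite.unop_op, mul_sub, sub_mul, pow_succ, pow_zero, one_mul, mul_assoc, huv, huv', hxu,
      hxu', hyu, hyu', hxv, hxv', mul_smul_comm, smul_mul_assoc, smul_smul, smul_sub] <;>
    match_scalars <;> simp at hp ⊢ <;> clear hxu hyu hxv huv hxu' hyu' hxv' huv' <;> grind
  · simp [h]

/-- Scalars governing a two-parameter quantum group: `a i j` is the braiding of `e i` with `e j`,
`d i` scales the commutator of `e i` and `f i`, and `m i j` is the degree in `e i` of the Serre
relation between `e i` and `e j`. -/
structure QDatum (K : Type*) [Field K] (N : ℕ) where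
  a : Fin N → Fin N → K
  d : Fin N → K
  m : Fin N → Fin N → ℕ
  m_mem : ∀ i j, i ≠ j → 1 ≤ m i j ∧ m i j ≤ 3
  cartan : ∀ i j, i ≠ j → a i j * a j i * a i i ^ (m i j - 1) = 1

variable {N : ℕ} (D : QDatum K N)

/-- The family `φ` satisfies the defining relations of the quantum group with datum `D`. -/
structure IsQRep (φ : Gen N → A) : Prop where
  comm : ∀ g g' : Gen N, g.toral → g'.toral → φ g * φ g' = φ g' * φ g
  w_winv : ∀ i, φ (.w i) * φ (.winv i) = 1
  wp_wpinv : ∀ i, φ (.wp i) * φ (.wpinv i) = 1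
  w_e : ∀ i j, φ (.w i) * φ (.e j) = D.a i j • (φ (.e j) * φ (.w i))
  f_w : ∀ i j, φ (.f j) * φ (.w i) = D.a i j • (φ (.w i) * φ (.f j))
  e_wp : ∀ i j, φ (.e j) * φ (.wp i) = D.a j i • (φ (.wp i) * φ (.e j))
  wp_f : ∀ i j, φ (.wp i) * φ (.f j) = D.a j i • (φ (.f j) * φ (.wp i))
  e_f : ∀ i j, φ (.e i) * φ (.f j) - φ (.f j) * φ (.e i)
    = if i = j then D.d i • (φ (.w i) - φ (.wp i)) else 0
  serre_e : ∀ i j, i ≠ j →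
    qSerre (D.a i i) (D.a i j) (φ (.e i)) (φ (.e j)) (D.m i j) = 0
  serre_f : ∀ i j, i ≠ j →
    qSerre (D.a i i) (D.a j i) (φ (.f i)) (φ (.f j)) (D.m i j) = 0

variable {D}

theorem mul_inv_eq_smul_of_mul_eq_smul {c : K} {x y z : A} (h : x * y = c • (y * x))
    (hl : z * x = 1) (hr : x * z = 1) : y * z = c • (z * y) := by
  calc y * z = z * (x * y) * z := by rw [← mul_assoc z, hl, one_mul]
    _ = c • (z * y) := by rw [h, mul_smul_comm, smul_mul_assoc, mul_assoc, mul_assoc, hr, mul_one]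

theorem inv_mul_eq_smul_of_mul_eq_smul {c : K} {x y z : A} (h : y * x = c • (x * y))
    (hl : z * x = 1) (hr : x * z = 1) : z * y = c • (y * z) := by
  calc z * y = z * (y * x) * z := by rw [mul_assoc, mul_assoc, hr, mul_one]
    _ = c • (y * z) := by rw [h, mul_smul_comm, smul_mul_assoc, ← mul_assoc, hl, one_mul]

namespace IsQRep

variable {φ : Gen N → A} (h : IsQRep D φ)
include h

theorem winv_w (i : Fin N) : φ (.winv i) * φ (.w i) = 1 := by
  rw [h.comm (.winv i) (.w i) trivial trivial, h.w_winv]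

theorem wpinv_wp (i : Fin N) : φ (.wpinv i) * φ (.wp i) = 1 := by
  rw [h.comm (.wpinv i) (.wp i) trivial trivial, h.wp_wpinv]

theorem e_winv (i j : Fin N) : φ (.e j) * φ (.winv i) = D.a i j • (φ (.winv i) * φ (.e j)) :=
  mul_inv_eq_smul_of_mul_eq_smul (h.w_e i j) (h.winv_w i) (h.w_winv i)

theorem winv_f (i j : Fin N) : φ (.winv i) * φ (.f j) = D.a i j • (φ (.f j) * φ (.winv i)) :=
  inv_mul_eq_smul_of_mul_eq_smul (h.f_w i j) (h.winv_w i) (h.w_winv i)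

theorem wpinv_e (i j : Fin N) : φ (.wpinv i) * φ (.e j) = D.a j i • (φ (.e j) * φ (.wpinv i)) :=
  inv_mul_eq_smul_of_mul_eq_smul (h.e_wp i j) (h.wpinv_wp i) (h.wp_wpinv i)

theorem f_wpinv (i j : Fin N) : φ (.f j) * φ (.wpinv i) = D.a j i • (φ (.wpinv i) * φ (.f j)) :=
  mul_inv_eq_smul_of_mul_eq_smul (h.wp_f i j) (h.wpinv_wp i) (h.wp_wpinv i)

end IsQRep

/-- The comultiplication on generators. -/
def comulGen (K : Type*) [Field K] [Algebra K A] (φ : Gen N → A) : Gen N → A ⊗[K] A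
  | .e i => φ (.e i) ⊗ₜ 1 + φ (.w i) ⊗ₜ φ (.e i)
  | .f i => 1 ⊗ₜ φ (.f i) + φ (.f i) ⊗ₜ φ (.wp i)
  | .w i => φ (.w i) ⊗ₜ φ (.w i)
  | .winv i => φ (.winv i) ⊗ₜ φ (.winv i)
  | .wp i => φ (.wp i) ⊗ₜ φ (.wp i)
  | .wpinv i => φ (.wpinv i) ⊗ₜ φ (.wpinv i)

/-- The counit on generators. -/
def counitGen (K : Type*) [Field K] : Gen N → K
  | .e _ => 0
  | .f _ => 0
  | _ => 1

/-- The antipode on generators, with values in the opposite algebra. -/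
def antipodeGen (φ : Gen N → A) : Gen N → Aᵐᵒᵖ
  | .e i => .op (-(φ (.winv i) * φ (.e i)))
  | .f i => .op (-(φ (.f i) * φ (.wpinv i)))
  | .w i => .op (φ (.winv i))
  | .winv i => .op (φ (.w i))
  | .wp i => .op (φ (.wpinv i))
  | .wpinv i => .op (φ (.wp i))

theorem isQRep_counitGen : IsQRep D (counitGen K : Gen N → K) where
  comm _ _ _ _ := mul_comm _ _
  w_winv _ := mul_one _
  wp_wpinv _ := mul_one _
  w_e _ _ := by simp [counitGen]
  f_w _ _ := by simp [counitGen]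
  e_wp _ _ := by simp [counitGen]
  wp_f _ _ := by simp [counitGen]
  e_f _ _ := by simp [counitGen]
  serre_e _ _ _ := qSerre_zero_zero _ _ _
  serre_f _ _ _ := qSerre_zero_zero _ _ _

theorem qSerre_tmul_left {q p : K} {u v x y : A} {m : ℕ} (huv : Commute u v)
    (h : qSerre q p x y m = 0) :
    qSerre q p (u ⊗ₜ[K] x) (v ⊗ₜ[K] y) m = 0 := by
  have := qSerre_mul_of_commute q p (u := u ⊗ₜ[K] (1 : A)) (v := v ⊗ₜ[K] (1 : A))
    (x := (1 : A) ⊗ₜ[K] x) (y := (1 : A) ⊗ₜ[K] y) (by simp [commute_iff_eq, huv.eq])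
    (by simp [commute_iff_eq]) (by simp [commute_iff_eq]) (by simp [commute_iff_eq]) m
  have h0 := map_qSerre (Algebra.TensorProduct.includeRight : A →ₐ[K] A ⊗[K] A) q p x y m
  simp only [h, map_zero, Algebra.TensorProduct.includeRight_apply] at h0
  simpa [← h0] using this

theorem qSerre_tmul_right {q p : K} {u v x y : A} {m : ℕ} (huv : Commute u v)
    (h : qSerre q p x y m = 0) :
    qSerre q p (x ⊗ₜ[K] u) (y ⊗ₜ[K] v) m = 0 := by
  have := congrArg (Algebra.TensorProduct.comm K A A) (qSerre_tmul_left huv h)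
  have h0 := map_qSerre (Algebra.TensorProduct.comm K A A).toAlgHom q p (u ⊗ₜ[K] x) (v ⊗ₜ[K] y) m
  simp_all

theorem IsQRep.comulGen {φ : Gen N → A} (h : IsQRep D φ) : IsQRep D (comulGen K φ) where
  comm g g' hg hg' := by
    cases g <;> cases g' <;>
      first
      | exact hg.elim
      | exact hg'.elim
      | (simp only [_root_.comulGen, Algebra.TensorProduct.tmul_mul_tmul]
         rw [h.comm _ _ hg hg'])
  w_winv i := by simp [_root_.comulGen, h.w_winv, Algebra.TensorProduct.one_def]
  wp_wpinv i := by simp [_root_.comulGen, h.wp_wpinv, Algebra.TensorProduct.one_def]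
  w_e i j := by
    simp [_root_.comulGen, mul_add, add_mul, h.w_e, h.comm (.w i) (.w j) trivial trivial,
      TensorProduct.smul_tmul']
  f_w i j := by
    simp [_root_.comulGen, mul_add, add_mul, h.f_w, h.comm (.w i) (.wp j) trivial trivial,
      TensorProduct.smul_tmul']
  e_wp i j := by
    simp [_root_.comulGen, mul_add, add_mul, h.e_wp, h.comm (.wp i) (.w j) trivial trivial,
      TensorProduct.smul_tmul']
  wp_f i j := by
    simp [_root_.comulGen, mul_add, add_mul, h.wp_f, h.comm (.wp i) (.wp j) trivial trivial,
      TensorProduct.smul_tmul']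
  e_f i j := by
    have h1 : (φ (.w i) * φ (.f j)) ⊗ₜ[K] (φ (.e i) * φ (.wp j))
        = (φ (.f j) * φ (.w i)) ⊗ₜ[K] (φ (.wp j) * φ (.e i)) := by
      rw [h.e_wp, h.f_w, TensorProduct.smul_tmul]
    have h2 := h.e_f i j
    rw [sub_eq_iff_eq_add] at h2
    simp only [_root_.comulGen, mul_add, add_mul, Algebra.TensorProduct.tmul_mul_tmul, one_mul,
      mul_one, h1, h2, TensorProduct.add_tmul, TensorProduct.tmul_add]
    split_ifs with hij
    · subst hij
      simp only [TensorProduct.tmul_smul, ← TensorProduct.smul_tmul', TensorProduct.tmul_sub,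
        TensorProduct.sub_tmul]
      module
    · simp only [TensorProduct.zero_tmul, TensorProduct.tmul_zero]
      abel
  serre_e i j hij := by
    have := qSerre_add (K := K) (q := D.a i i) (p := D.a i j) (p' := D.a j i)
      (x := φ (.e i) ⊗ₜ[K] (1 : A)) (y := φ (.e j) ⊗ₜ[K] (1 : A))
      (x' := φ (.w i) ⊗ₜ[K] φ (.e i)) (y' := φ (.w j) ⊗ₜ[K] φ (.e j)) (D.m_mem i j hij)
      (by simp [h.w_e, TensorProduct.smul_tmul'])
      (by simp [h.w_e, TensorProduct.smul_tmul'])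
      (by simp [h.w_e, TensorProduct.smul_tmul']) (D.cartan i j hij)
    rw [_root_.comulGen, _root_.comulGen, this,
      qSerre_tmul_right (Commute.refl 1) (h.serre_e i j hij),
      qSerre_tmul_left (h.comm (.w i) (.w j) trivial trivial) (h.serre_e i j hij), add_zero]
  serre_f i j hij := by
    have := qSerre_add (K := K) (q := D.a i i) (p := D.a j i) (p' := D.a i j)
      (x := (1 : A) ⊗ₜ[K] φ (.f i)) (y := (1 : A) ⊗ₜ[K] φ (.f j))
      (x' := φ (.f i) ⊗ₜ[K] φ (.wp i)) (y' := φ (.f j) ⊗ₜ[K] φ (.wp j)) (D.m_mem i j hij)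
      (by simp [h.wp_f])
      (by simp [h.wp_f])
      (by simp [h.wp_f]) (by rw [mul_comm (D.a j i), D.cartan i j hij])
    rw [_root_.comulGen, _root_.comulGen, this,
      qSerre_tmul_left (Commute.refl 1) (h.serre_f i j hij),
      qSerre_tmul_right (h.comm (.wp i) (.wp j) trivial trivial) (h.serre_f i j hij), add_zero]

theorem IsQRep.antipodeGen {φ : Gen N → A} (h : IsQRep D φ) : IsQRep D (antipodeGen φ) where
  comm g g' hg hg' := by
    cases g <;> cases g' <;>
      first
      | exact hg.elim
      | exact hg'.elim
      | exact congrArg MulOpposite.op (h.comm _ _ hg' hg)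
  w_winv i := by simp [_root_.antipodeGen, ← MulOpposite.op_mul, h.w_winv]
  wp_wpinv i := by simp [_root_.antipodeGen, ← MulOpposite.op_mul, h.wp_wpinv]
  w_e i j := by
    simp only [_root_.antipodeGen, ← MulOpposite.op_mul, ← MulOpposite.op_smul]
    rw [neg_mul, mul_neg, mul_assoc, h.e_winv, mul_smul_comm, ← mul_assoc, ← mul_assoc,
      h.comm (.winv i) (.winv j) trivial trivial, smul_neg]
  f_w i j := by
    simp only [_root_.antipodeGen, ← MulOpposite.op_mul, ← MulOpposite.op_smul]
    rw [neg_mul, mul_neg, ← mul_assoc, h.winv_f, smul_mul_assoc, mul_assoc, mul_assoc,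
      h.comm (.winv i) (.wpinv j) trivial trivial, smul_neg]
  e_wp i j := by
    simp only [_root_.antipodeGen, ← MulOpposite.op_mul, ← MulOpposite.op_smul]
    rw [neg_mul, mul_neg, ← mul_assoc, h.comm (.wpinv i) (.winv j) trivial trivial, mul_assoc,
      h.wpinv_e, mul_smul_comm, mul_assoc, smul_neg]
  wp_f i j := by
    simp only [_root_.antipodeGen, ← MulOpposite.op_mul, ← MulOpposite.op_smul]
    rw [neg_mul, mul_neg, mul_assoc, h.comm (.wpinv j) (.wpinv i) trivial trivial, ← mul_assoc,
      h.f_wpinv, smul_mul_assoc, mul_assoc, smul_neg]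
  e_f i j := by
    have h1 : φ (.f j) * φ (.wpinv j) * (φ (.winv i) * φ (.e i))
        = φ (.winv i) * (φ (.f j) * φ (.e i)) * φ (.wpinv j) := by
      have h2 : φ (.f j) * φ (.wpinv j) * (φ (.winv i) * φ (.e i))
          = φ (.f j) * φ (.winv i) * (φ (.wpinv j) * φ (.e i)) := by
        rw [mul_assoc, ← mul_assoc (φ (.wpinv j)), h.comm (.wpinv j) (.winv i) trivial trivial]
        simp only [mul_assoc]
      rw [h2, h.wpinv_e, ← mul_assoc (φ (.winv i)), h.winv_f]
      simp only [mul_smul_comm, smul_mul_assoc, mul_assoc]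
    apply MulOpposite.unop_injective
    have h2 := h.e_f i j
    rw [sub_eq_iff_eq_add] at h2
    have h3 : φ (.winv i) * φ (.e i) * (φ (.f j) * φ (.wpinv j))
        = φ (.winv i) * (φ (.e i) * φ (.f j)) * φ (.wpinv j) := by simp only [mul_assoc]
    simp only [_root_.antipodeGen, MulOpposite.unop_sub, MulOpposite.unop_mul,
      MulOpposite.unop_op, neg_mul_neg, h1, h3, h2]
    split_ifs with hij
    · subst hij
      have h4 : φ (.winv i) * φ (.wp i) * φ (.wpinv i) = φ (.winv i) := by
        rw [mul_assoc, h.wp_wpinv, mul_one]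
      simp [mul_add, add_mul, mul_sub, sub_mul, h4, h.winv_w, ← smul_neg]
    · simp
  serre_e i j hij := by
    have := qSerre_op_eq_zero (K := K) (u := φ (.winv i)) (v := φ (.winv j)) (D.m_mem i j hij)
      (h.comm _ _ trivial trivial) (h.e_winv i i) (h.e_winv i j) (h.e_winv j i) (D.cartan i j hij)
      (h.serre_e i j hij)
    have h2 := qSerre_smul (D.a i i) (D.a i j) (-1 : K) (-1)
      (MulOpposite.op (φ (.winv i) * φ (.e i))) (MulOpposite.op (φ (.winv j) * φ (.e j))) (D.m i j)
    rw [this, smul_zero] at h2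
    simpa [_root_.antipodeGen] using h2
  serre_f i j hij := by
    have := qSerre_op_eq_zero (K := K) (u := φ (.wpinv i)) (v := φ (.wpinv j)) (D.m_mem i j hij)
      (h.comm _ _ trivial trivial) (h.f_wpinv i i) (h.f_wpinv i j) (h.f_wpinv j i)
      (by rw [mul_comm (D.a j i), D.cartan i j hij]) (h.serre_f i j hij)
    have h2 := qSerre_smul (D.a i i) (D.a j i) (-D.a i i) (-D.a j j)
      (MulOpposite.op (φ (.wpinv i) * φ (.f i))) (MulOpposite.op (φ (.wpinv j) * φ (.f j))) (D.m i j)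
    rw [this, smul_zero] at h2
    simpa [_root_.antipodeGen, h.f_wpinv] using h2

end QuantumDouble

section TypeB

theorem qr_ne_zero : qr ≠ 0 := by
  simp [qr, MvPolynomial.X_ne_zero]

theorem qs_ne_zero : qs ≠ 0 := by
  simp [qs, MvPolynomial.X_ne_zero]

/-- The braiding scalars of type `B`: `ω_i e_j = aB n i j • e_j ω_i`. -/
def aB (n : ℕ) (i j : Fin (n + 1)) : KK :=
  if i = j then riB n qr i * (riB n qs i)⁻¹
  else if (j : ℕ) = i + 1 then qs ^ 2
  else if (i : ℕ) = j + 1 then (qr ^ 2)⁻¹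
  else 1

/-- The degrees of the Serre relations of type `B`. -/
def mB (n : ℕ) (i j : Fin (n + 1)) : ℕ :=
  if (j : ℕ) = i + 1 ∨ (i : ℕ) = j + 1 then (if (i : ℕ) = n then 3 else 2) else 1

variable {n : ℕ}

theorem aB_self_of_lt {i : Fin (n + 1)} (h : (i : ℕ) < n) :
    aB n i i = qr ^ 2 * (qs ^ 2)⁻¹ := by
  simp [aB, riB, h]

theorem aB_last_last : aB n (Fin.last n) (Fin.last n) = qr * qs⁻¹ := by
  simp [aB, riB]

theorem aB_of_succ {i j : Fin (n + 1)} (h : (j : ℕ) = i + 1) : aB n i j = qs ^ 2 := by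
  have : i ≠ j := by rintro rfl; omega
  simp [aB, this, h]

theorem aB_of_pred {i j : Fin (n + 1)} (h : (i : ℕ) = j + 1) : aB n i j = (qr ^ 2)⁻¹ := by
  have : i ≠ j := by rintro rfl; omega
  have h' : (j : ℕ) ≠ i + 1 := by omega
  rw [aB, if_neg this, if_neg h', if_pos h]

theorem aB_of_far {i j : Fin (n + 1)} (h : (i : ℕ) + 1 < j ∨ (j : ℕ) + 1 < i) : aB n i j = 1 := by
  have : i ≠ j := by rintro rfl; omega
  rw [aB, if_neg this, if_neg (by omega), if_neg (by omega)]

theorem mB_of_far {i j : Fin (n + 1)} (h : (i : ℕ) + 1 < j ∨ (j : ℕ) + 1 < i) : mB n i j = 1 := by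
  rw [mB, if_neg (by omega)]

theorem mB_of_lt {i j : Fin (n + 1)} (h : (j : ℕ) = i + 1 ∨ (i : ℕ) = j + 1) (hi : (i : ℕ) < n) :
    mB n i j = 2 := by
  rw [mB, if_pos h, if_neg hi.ne]

theorem mB_last {j : Fin (n + 1)} (h : (j : ℕ) + 1 = n) : mB n (Fin.last n) j = 3 := by
  rw [mB, if_pos (.inr (by simp [h])), if_pos (by simp)]

theorem adjacent_cases {i j : Fin (n + 1)} (h : i ≠ j) :
    ((j : ℕ) = i + 1 ∧ (i : ℕ) < n) ∨ ((i : ℕ) = j + 1 ∧ (i : ℕ) < n) ∨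
      ((j : ℕ) + 1 = n ∧ i = Fin.last n) ∨ ((i : ℕ) + 1 < j ∨ (j : ℕ) + 1 < i) := by
  have := Fin.val_ne_of_ne h
  simp only [Fin.ext_iff, Fin.val_last]
  omega

theorem aB_ne_zero (i j : Fin (n + 1)) : aB n i j ≠ 0 := by
  have h1 := qr_ne_zero
  have h2 := qs_ne_zero
  unfold aB riB
  split_ifs <;> simp [h1, h2]

/-- The datum of the two-parameter quantum group of type `B`. -/
def datumB (n : ℕ) : QDatum KK (n + 1) where
  a := aB n
  d i := (riB n qr i - riB n qs i)⁻¹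
  m := mB n
  m_mem i j _ := by unfold mB; split_ifs <;> simp
  cartan i j hij := by
    have h1 := qr_ne_zero
    have h2 := qs_ne_zero
    rcases adjacent_cases hij with ⟨h, hi⟩ | ⟨h, hi⟩ | ⟨h, rfl⟩ | h
    · rw [aB_of_succ h, aB_of_pred h, aB_self_of_lt hi, mB_of_lt (.inl h) hi]
      simp; field_simp
    · rw [aB_of_succ h, aB_of_pred h, aB_self_of_lt hi, mB_of_lt (.inr h) hi]
      simp; field_simp
    · rw [aB_of_pred (i := Fin.last n) (j := j) h.symm, aB_of_succ (i := j) (j := Fin.last n) h.symm,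
        aB_last_last, mB_last h]
      simp; field_simp
    · rw [aB_of_far h, aB_of_far h.symm, mB_of_far h]
      simp

theorem braiding_eq_aB (i j : Fin (n + 1)) (hj : (j : ℕ) < n) :
    riB n qr j ^ ipaB n j i * riB n qs j ^ ipaB n (j + 1) i = aB n j i := by
  have h1 := qr_ne_zero
  have h2 := qs_ne_zero
  have hi := i.is_le
  simp only [ipaB, riB, aB, hj, if_true, Fin.ext_iff]
  split_ifs <;> first | omega | simp

theorem braiding_swap_eq_aB_inv (i j : Fin (n + 1)) (hj : (j : ℕ) < n) :
    riB n qs j ^ ipaB n j i * riB n qr j ^ ipaB n (j + 1) i = (aB n i j)⁻¹ := by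
  have h1 := qr_ne_zero
  have h2 := qs_ne_zero
  have hi := i.is_le
  simp only [ipaB, riB, aB, hj, Fin.ext_iff]
  split_ifs <;> first | omega | simp [mul_comm]

theorem braiding_last_eq_aB (j : Fin (n + 1)) (hj : (j : ℕ) < n) :
    riB n qr n ^ (2 * ipaB n n j) = aB n (Fin.last n) j := by
  simp only [ipaB, riB, aB, hj, if_true, Fin.ext_iff, Fin.val_last]
  split_ifs <;> first | omega | simp [zpow_neg]

theorem braiding_last_swap_eq_aB_inv (j : Fin (n + 1)) (hj : (j : ℕ) < n) :
    riB n qs n ^ (2 * ipaB n n j) = (aB n j (Fin.last n))⁻¹ := by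
  simp only [ipaB, riB, aB, hj, if_true, Fin.ext_iff, Fin.val_last]
  split_ifs <;> first | omega | simp [zpow_neg]

section Serre

variable {K A : Type*} [Field K] [Ring A] [Algebra K A] {q p c₁ c₂ c₃ : K}

theorem qSerre_one (q p : K) (x y : A) : qSerre q p x y 1 = x * y - p • (y * x) := by
  simp [qSerre]

theorem qSerre_two (h₁ : p * (1 + q) = c₁) (h₂ : q * p ^ 2 = c₂) (x y : A) :
    x ^ 2 * y - c₁ • (x * y * x) + c₂ • (y * x ^ 2) = qSerre q p x y 2 := by
  subst h₁ h₂
  simp only [qSerre, mul_sub, sub_mul, mul_smul_comm, smul_mul_assoc, ← mul_assoc, pow_two]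
  module

theorem qSerre_two_rev (h₁ : c₂ * (p * (1 + q)) = c₁) (h₂ : c₂ * (q * p ^ 2) = 1) (x y : A) :
    y * x ^ 2 - c₁ • (x * y * x) + c₂ • (x ^ 2 * y) = c₂ • qSerre q p x y 2 := by
  rw [← qSerre_two rfl rfl, ← h₁, smul_add, smul_sub, smul_smul, smul_smul, h₂]
  module

theorem qSerre_three (h₁ : p * (1 + q + q ^ 2) = c₁) (h₂ : q * p ^ 2 * (1 + q + q ^ 2) = c₂)
    (h₃ : q ^ 3 * p ^ 3 = c₃) (x y : A) :
    x ^ 3 * y - c₁ • (x ^ 2 * y * x) + c₂ • (x * y * x ^ 2) - c₃ • (y * x ^ 3)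
      = qSerre q p x y 3 := by
  subst h₁ h₂ h₃
  simp only [qSerre, mul_sub, sub_mul, mul_smul_comm, smul_mul_assoc, ← mul_assoc, pow_succ,
    pow_zero, one_mul]
  module

theorem qSerre_three_rev (h₁ : c₃ * (q * p ^ 2 * (1 + q + q ^ 2)) = c₁)
    (h₂ : c₃ * (p * (1 + q + q ^ 2)) = c₂) (h₃ : c₃ * (q ^ 3 * p ^ 3) = 1) (x y : A) :
    y * x ^ 3 - c₁ • (x * y * x ^ 2) + c₂ • (x ^ 2 * y * x) - c₃ • (x ^ 3 * y)
      = -c₃ • qSerre q p x y 3 := by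
  rw [← qSerre_three rfl rfl rfl, ← h₁, ← h₂, smul_sub, smul_add, smul_sub]
  simp only [smul_smul, neg_mul, h₃]
  module

theorem mul_mul_inv_eq_smul_iff {c : K} {x z y : A} (hl : z * x = 1) (hr : x * z = 1) :
    x * y * z = c • y ↔ x * y = c • (y * x) := by
  constructor <;> intro h
  · rw [← smul_mul_assoc, ← h, mul_assoc, hl, mul_one]
  · rw [h, smul_mul_assoc, mul_assoc, hr, mul_one]

theorem mul_mul_inv_eq_inv_smul_iff {c : K} (hc : c ≠ 0) {x z y : A} (hl : z * x = 1)
    (hr : x * z = 1) : x * y * z = c⁻¹ • y ↔ y * x = c • (x * y) := by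
  rw [mul_mul_inv_eq_smul_iff hl hr, eq_inv_smul_iff₀ hc, eq_comm]

end Serre

theorem serre_scalars_two {i : Fin (n + 1)} (hi : (i : ℕ) < n) :
    qs ^ 2 * (1 + aB n i i) = riB n qr i + riB n qs i ∧
    aB n i i * (qs ^ 2) ^ 2 = riB n qr i * riB n qs i ∧
    (qr ^ 2)⁻¹ * (1 + aB n i i) = (riB n qr i)⁻¹ + (riB n qs i)⁻¹ ∧
    aB n i i * ((qr ^ 2)⁻¹) ^ 2 = (riB n qr i * riB n qs i)⁻¹ := by
  have h1 := qr_ne_zero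
  have h2 := qs_ne_zero
  rw [aB_self_of_lt hi]
  simp only [riB, hi, if_true]
  refine ⟨?_, ?_, ?_, ?_⟩ <;> (field_simp; try ring)

theorem serre_scalars_two_rev {i : Fin (n + 1)} (hi : (i : ℕ) < n) :
    riB n qr i * riB n qs i * ((qr ^ 2)⁻¹ * (1 + aB n i i)) = riB n qr i + riB n qs i ∧
    riB n qr i * riB n qs i * (aB n i i * ((qr ^ 2)⁻¹) ^ 2) = 1 ∧
    (riB n qr i * riB n qs i)⁻¹ * (qs ^ 2 * (1 + aB n i i)) =
      (riB n qr i)⁻¹ + (riB n qs i)⁻¹ ∧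
    (riB n qr i * riB n qs i)⁻¹ * (aB n i i * (qs ^ 2) ^ 2) = 1 := by
  have h1 := qr_ne_zero
  have h2 := qs_ne_zero
  rw [aB_self_of_lt hi]
  simp only [riB, hi, if_true]
  refine ⟨?_, ?_, ?_, ?_⟩ <;> (field_simp; try ring)

theorem serre_scalars_three :
    (qr ^ 2)⁻¹ * (1 + qr * qs⁻¹ + (qr * qs⁻¹) ^ 2)
      = qr ^ (-2 : ℤ) + qr⁻¹ * qs⁻¹ + qs ^ (-2 : ℤ) ∧
    qr * qs⁻¹ * ((qr ^ 2)⁻¹) ^ 2 * (1 + qr * qs⁻¹ + (qr * qs⁻¹) ^ 2)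
      = (qr * qs)⁻¹ * (qr ^ (-2 : ℤ) + qr⁻¹ * qs⁻¹ + qs ^ (-2 : ℤ)) ∧
    (qr * qs⁻¹) ^ 3 * ((qr ^ 2)⁻¹) ^ 3 = (qr * qs) ^ (-3 : ℤ) := by
  have h1 := qr_ne_zero
  have h2 := qs_ne_zero
  refine ⟨?_, ?_, ?_⟩ <;> simp only [zpow_neg, zpow_ofNat] <;> field_simp

theorem serre_scalars_three_rev :
    (qr * qs) ^ (-3 : ℤ) * (qr * qs⁻¹ * (qs ^ 2) ^ 2 * (1 + qr * qs⁻¹ + (qr * qs⁻¹) ^ 2))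
      = qr ^ (-2 : ℤ) + qr⁻¹ * qs⁻¹ + qs ^ (-2 : ℤ) ∧
    (qr * qs) ^ (-3 : ℤ) * (qs ^ 2 * (1 + qr * qs⁻¹ + (qr * qs⁻¹) ^ 2))
      = (qr * qs)⁻¹ * (qr ^ (-2 : ℤ) + qr⁻¹ * qs⁻¹ + qs ^ (-2 : ℤ)) ∧
    (qr * qs) ^ (-3 : ℤ) * ((qr * qs⁻¹) ^ 3 * (qs ^ 2) ^ 3) = 1 := by
  have h1 := qr_ne_zero
  have h2 := qs_ne_zero
  refine ⟨?_, ?_, ?_⟩ <;> simp only [zpow_neg, zpow_ofNat] <;> field_simp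

theorem braiding_neg_eq_aB_inv (i j : Fin (n + 1)) (hj : (j : ℕ) < n) :
    riB n qr j ^ (-ipaB n j i) * riB n qs j ^ (-ipaB n (j + 1) i) = (aB n j i)⁻¹ := by
  rw [zpow_neg, zpow_neg, ← mul_inv, braiding_eq_aB i j hj]

theorem braiding_swap_neg_eq_aB (i j : Fin (n + 1)) (hj : (j : ℕ) < n) :
    riB n qs j ^ (-ipaB n j i) * riB n qr j ^ (-ipaB n (j + 1) i) = aB n i j := by
  rw [zpow_neg, zpow_neg, ← mul_inv, braiding_swap_eq_aB_inv i j hj, inv_inv]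

theorem aB_last : riB n qr n * (riB n qs n)⁻¹ = aB n (Fin.last n) (Fin.last n) := by
  simp [aB]

theorem aB_last_inv : (riB n qr n)⁻¹ * riB n qs n = (aB n (Fin.last n) (Fin.last n))⁻¹ := by
  simp [aB, mul_comm]

theorem aB_last_swap_inv : riB n qs n * (riB n qr n)⁻¹ = (aB n (Fin.last n) (Fin.last n))⁻¹ := by
  simp [aB]

theorem aB_last_swap : (riB n qs n)⁻¹ * riB n qr n = aB n (Fin.last n) (Fin.last n) := by
  simp [aB, mul_comm]

theorem eq_last_of_not_lt {i : Fin (n + 1)} (h : ¬ (i : ℕ) < n) : i = Fin.last n := by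
  ext
  have := i.is_le
  simp
  omega

variable {A : Type*} [Ring A] [Algebra KK A] {φ : Gen (n + 1) → A}

/-- A family of generators satisfies the relations in `RelB` when evaluation respects them. -/
theorem isQRep_of_forall_relB
    (h : ∀ x y, RelB n x y → FreeAlgebra.lift KK φ x = FreeAlgebra.lift KK φ y) :
    IsQRep (datumB n) φ := by
  have wl (i) := h _ _ (.winv_l i)
  have wr (i) := h _ _ (.winv_r i)
  have wpl (i) := h _ _ (.wpinv_l i)
  have wpr (i) := h _ _ (.wpinv_r i)
  simp only [XB, map_mul, map_one, FreeAlgebra.lift_ι_apply] at wl wr wpl wpr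
  refine ⟨fun g g' hg hg' => ?_, wr, wpr, fun i j => ?_, fun i j => ?_, fun i j => ?_,
    fun i j => ?_, fun i j => ?_, fun i j hij => ?_, fun i j hij => ?_⟩
  · simpa [XB] using h _ _ (.comm g g' hg hg')
  · change _ = aB n i j • _
    rw [← mul_mul_inv_eq_smul_iff (wl i) (wr i)]
    by_cases hi : (i : ℕ) < n
    · simpa only [XB, map_mul, map_smul, FreeAlgebra.lift_ι_apply, braiding_eq_aB j i hi]
        using h _ _ (.b2we j i hi)
    obtain rfl := eq_last_of_not_lt hi
    by_cases hj : (j : ℕ) < n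
    · simpa only [XB, map_mul, map_smul, FreeAlgebra.lift_ι_apply, braiding_last_eq_aB j hj]
        using h _ _ (.b2wne j hj)
    obtain rfl := eq_last_of_not_lt hj
    simpa only [XB, map_mul, map_smul, FreeAlgebra.lift_ι_apply, aB_last] using h _ _ .b2wnen
  · change _ = aB n i j • _
    rw [← mul_mul_inv_eq_inv_smul_iff (aB_ne_zero i j) (wl i) (wr i)]
    by_cases hi : (i : ℕ) < n
    · simpa only [XB, map_mul, map_smul, FreeAlgebra.lift_ι_apply, braiding_neg_eq_aB_inv j i hi]
        using h _ _ (.b2wf j i hi)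
    obtain rfl := eq_last_of_not_lt hi
    by_cases hj : (j : ℕ) < n
    · simpa only [XB, map_mul, map_smul, FreeAlgebra.lift_ι_apply, zpow_neg,
        braiding_last_eq_aB j hj] using h _ _ (.b2wnf j hj)
    obtain rfl := eq_last_of_not_lt hj
    simpa only [XB, map_mul, map_smul, FreeAlgebra.lift_ι_apply, aB_last_inv] using h _ _ .b2wnfn
  · change _ = aB n j i • _
    rw [← mul_mul_inv_eq_inv_smul_iff (aB_ne_zero j i) (wpl i) (wpr i)]
    by_cases hi : (i : ℕ) < n
    · simpa only [XB, map_mul, map_smul, FreeAlgebra.lift_ι_apply, braiding_swap_eq_aB_inv j i hi]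
        using h _ _ (.b3wpe j i hi)
    obtain rfl := eq_last_of_not_lt hi
    by_cases hj : (j : ℕ) < n
    · simpa only [XB, map_mul, map_smul, FreeAlgebra.lift_ι_apply,
        braiding_last_swap_eq_aB_inv j hj] using h _ _ (.b3wpne j hj)
    obtain rfl := eq_last_of_not_lt hj
    simpa only [XB, map_mul, map_smul, FreeAlgebra.lift_ι_apply, aB_last_swap_inv]
      using h _ _ .b3wpnen
  · change _ = aB n j i • _
    rw [← mul_mul_inv_eq_smul_iff (wpl i) (wpr i)]
    by_cases hi : (i : ℕ) < n
    · simpa only [XB, map_mul, map_smul, FreeAlgebra.lift_ι_apply, braiding_swap_neg_eq_aB j i hi]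
        using h _ _ (.b3wpf j i hi)
    obtain rfl := eq_last_of_not_lt hi
    by_cases hj : (j : ℕ) < n
    · simpa only [XB, map_mul, map_smul, FreeAlgebra.lift_ι_apply, zpow_neg, inv_inv,
        braiding_last_swap_eq_aB_inv j hj] using h _ _ (.b3wpnf j hj)
    obtain rfl := eq_last_of_not_lt hj
    simpa only [XB, map_mul, map_smul, FreeAlgebra.lift_ι_apply, aB_last_swap]
      using h _ _ .b3wpnfn
  · change _ = if i = j then (riB n qr i - riB n qs i)⁻¹ • _ else 0
    have := h _ _ (.b4 i j)
    rw [apply_ite (FreeAlgebra.lift KK φ)] at this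
    simpa only [XB, map_mul, map_sub, map_smul, map_zero, FreeAlgebra.lift_ι_apply] using this
  · change qSerre (aB n i i) (aB n i j) _ _ (mB n i j) = 0
    rcases adjacent_cases hij with ⟨hj, hi⟩ | ⟨hj, hi⟩ | ⟨hj, rfl⟩ | hj
    · have := h _ _ (.b6a i j hj hi)
      obtain ⟨h₁, h₂, -, -⟩ := serre_scalars_two hi
      simp only [XB, map_mul, map_sub, map_add, map_pow, map_smul, map_zero,
        FreeAlgebra.lift_ι_apply] at this
      rw [mB_of_lt (.inl hj) hi, aB_of_succ hj]
      rwa [qSerre_two h₁ h₂] at this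
    · have := h _ _ (.b6b j i hj (hj ▸ hi))
      rw [← hj] at this
      obtain ⟨-, -, h₁, h₂⟩ := serre_scalars_two hi
      simp only [XB, map_mul, map_sub, map_add, map_pow, map_smul, map_zero,
        FreeAlgebra.lift_ι_apply] at this
      rw [mB_of_lt (.inr hj) hi, aB_of_pred hj]
      rwa [qSerre_two h₁ h₂] at this
    · have := h _ _ (.b6c j hj)
      obtain ⟨h₁, h₂, h₃⟩ := serre_scalars_three
      simp only [XB, map_mul, map_sub, map_add, map_pow, map_smul, map_zero,
        FreeAlgebra.lift_ι_apply] at this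
      rw [mB_last hj, aB_last_last, aB_of_pred (i := Fin.last n) (j := j) hj.symm]
      rwa [qSerre_three h₁ h₂ h₃] at this
    · have := h _ _ (.b5e i j hj)
      simpa [XB, qSerre_one, mB_of_far hj, aB_of_far hj] using this
  · change qSerre (aB n i i) (aB n j i) _ _ (mB n i j) = 0
    rcases adjacent_cases hij with ⟨hj, hi⟩ | ⟨hj, hi⟩ | ⟨hj, rfl⟩ | hj
    · have := h _ _ (.b7a i j hj hi)
      obtain ⟨h₁, h₂, -, -⟩ := serre_scalars_two_rev hi
      simp only [XB, map_mul, map_sub, map_add, map_pow, map_smul, map_zero,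
        FreeAlgebra.lift_ι_apply] at this
      rw [qSerre_two_rev h₁ h₂] at this
      rw [mB_of_lt (.inl hj) hi, aB_of_pred hj]
      exact (smul_eq_zero_iff_right (left_ne_zero_of_mul_eq_one h₂)).1 this
    · have := h _ _ (.b7b j i hj (hj ▸ hi))
      rw [← hj] at this
      obtain ⟨-, -, h₁, h₂⟩ := serre_scalars_two_rev hi
      simp only [XB, map_mul, map_sub, map_add, map_pow, map_smul, map_zero,
        FreeAlgebra.lift_ι_apply] at this
      rw [qSerre_two_rev h₁ h₂] at this
      rw [mB_of_lt (.inr hj) hi, aB_of_succ hj]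
      exact (smul_eq_zero_iff_right (left_ne_zero_of_mul_eq_one h₂)).1 this
    · have := h _ _ (.b7c j hj)
      obtain ⟨h₁, h₂, h₃⟩ := serre_scalars_three_rev
      simp only [XB, map_mul, map_sub, map_add, map_pow, map_smul, map_zero,
        FreeAlgebra.lift_ι_apply] at this
      rw [qSerre_three_rev h₁ h₂ h₃] at this
      rw [mB_last hj, aB_last_last, aB_of_succ (i := j) (j := Fin.last n) hj.symm]
      exact (smul_eq_zero_iff_right (neg_ne_zero.2 (left_ne_zero_of_mul_eq_one h₃))).1 this
    · have := h _ _ (.b5f i j hj)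
      simpa [XB, qSerre_one, mB_of_far hj, aB_of_far hj.symm] using this

theorem IsQRep.lift_eq_of_relB (h : IsQRep (datumB n) φ) {x y : FB n} (hxy : RelB n x y) :
    FreeAlgebra.lift KK φ x = FreeAlgebra.lift KK φ y := by
  have serre_e : ∀ i j, i ≠ j →
    qSerre (aB n i i) (aB n i j) (φ (.e i)) (φ (.e j)) (mB n i j) = 0 := h.serre_e
  have serre_f : ∀ i j, i ≠ j →
    qSerre (aB n i i) (aB n j i) (φ (.f i)) (φ (.f j)) (mB n i j) = 0 := h.serre_f
  have w_e (i j) : _ = aB n i j • _ :=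
    (mul_mul_inv_eq_smul_iff (h.winv_w i) (h.w_winv i)).2 (h.w_e i j)
  have w_f (i j) :=
    (mul_mul_inv_eq_inv_smul_iff (aB_ne_zero i j) (h.winv_w i) (h.w_winv i)).2 (h.f_w i j)
  have wp_e (i j) :=
    (mul_mul_inv_eq_inv_smul_iff (aB_ne_zero j i) (h.wpinv_wp i) (h.wp_wpinv i)).2 (h.e_wp i j)
  have wp_f (i j) : _ = aB n j i • _ :=
    (mul_mul_inv_eq_smul_iff (h.wpinv_wp i) (h.wp_wpinv i)).2 (h.wp_f i j)
  have ne_of_succ {i j : Fin (n + 1)} (hij : (j : ℕ) = i + 1) : i ≠ j := by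
    rintro rfl
    omega
  have ne_of_far {i j : Fin (n + 1)} (hij : (i : ℕ) + 1 < j ∨ (j : ℕ) + 1 < i) : i ≠ j := by
    rintro rfl
    omega
  cases hxy <;> simp only [XB, apply_ite (FreeAlgebra.lift KK φ), map_mul, map_sub, map_add,
    map_pow, map_smul, map_zero, map_one, FreeAlgebra.lift_ι_apply]
  case comm g g' hg hg' => exact h.comm g g' hg hg'
  case b4 i j => exact h.e_f i j
  case winv_r i => exact h.w_winv i
  case winv_l i => exact h.winv_w i
  case wpinv_r i => exact h.wp_wpinv i
  case wpinv_l i => exact h.wpinv_wp i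
  case b2we i j hj => rw [braiding_eq_aB i j hj]; exact w_e j i
  case b2wf i j hj => rw [braiding_neg_eq_aB_inv i j hj]; exact w_f j i
  case b2wne j hj => rw [braiding_last_eq_aB j hj]; exact w_e _ j
  case b2wnf j hj => rw [zpow_neg, braiding_last_eq_aB j hj]; exact w_f _ j
  case b2wnen => rw [aB_last]; exact w_e _ _
  case b2wnfn => rw [aB_last_inv]; exact w_f _ _
  case b3wpe i j hj => rw [braiding_swap_eq_aB_inv i j hj]; exact wp_e j i
  case b3wpf i j hj => rw [braiding_swap_neg_eq_aB i j hj]; exact wp_f j i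
  case b3wpne j hj => rw [braiding_last_swap_eq_aB_inv j hj]; exact wp_e _ j
  case b3wpnf j hj => rw [zpow_neg, braiding_last_swap_eq_aB_inv j hj, inv_inv]; exact wp_f _ j
  case b3wpnen => rw [aB_last_swap_inv]; exact wp_e _ _
  case b3wpnfn => rw [aB_last_swap]; exact wp_f _ _
  case b5e i j hij =>
    have := serre_e i j (ne_of_far hij)
    simpa [qSerre_one, mB_of_far hij, aB_of_far hij] using this
  case b5f i j hij =>
    have := serre_f i j (ne_of_far hij)
    simpa [qSerre_one, mB_of_far hij, aB_of_far hij.symm] using this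
  case b6a i j hij hi =>
    obtain ⟨h₁, h₂, -, -⟩ := serre_scalars_two hi
    rw [qSerre_two h₁ h₂, ← serre_e i j (ne_of_succ hij), mB_of_lt (.inl hij) hi, aB_of_succ hij]
  case b6b i j hij hj =>
    rw [← hij] at hj ⊢
    obtain ⟨-, -, h₁, h₂⟩ := serre_scalars_two hj
    rw [qSerre_two h₁ h₂, ← serre_e j i (ne_of_succ hij).symm, mB_of_lt (.inr hij) hj,
      aB_of_pred hij]
  case b6c i hi =>
    obtain ⟨h₁, h₂, h₃⟩ := serre_scalars_three
    have hin : ((Fin.last n : Fin (n + 1)) : ℕ) = i + 1 := hi.symm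
    rw [qSerre_three h₁ h₂ h₃, ← serre_e _ i (ne_of_succ hin).symm, mB_last hi, aB_last_last,
      aB_of_pred hin]
  case b7a i j hij hi =>
    obtain ⟨h₁, h₂, -, -⟩ := serre_scalars_two_rev hi
    have := serre_f i j (ne_of_succ hij)
    rw [mB_of_lt (.inl hij) hi, aB_of_pred hij] at this
    rw [qSerre_two_rev h₁ h₂, this, smul_zero]
  case b7b i j hij hj =>
    rw [← hij] at hj ⊢
    obtain ⟨-, -, h₁, h₂⟩ := serre_scalars_two_rev hj
    have := serre_f j i (ne_of_succ hij).symm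
    rw [mB_of_lt (.inr hij) hj, aB_of_succ hij] at this
    rw [qSerre_two_rev h₁ h₂, this, smul_zero]
  case b7c i hi =>
    obtain ⟨h₁, h₂, h₃⟩ := serre_scalars_three_rev
    have hin : ((Fin.last n : Fin (n + 1)) : ℕ) = i + 1 := hi.symm
    have := serre_f _ i (ne_of_succ hin).symm
    rw [mB_last hi, aB_last_last, aB_of_succ hin] at this
    rw [qSerre_three_rev h₁ h₂ h₃, this, smul_zero]

theorem isQRep_genB (n : ℕ) : IsQRep (datumB n) (genB n) := by
  have hlift : FreeAlgebra.lift KK (genB n) = RingQuot.mkAlgHom KK (RelB n) :=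
    FreeAlgebra.hom_ext (funext fun g => by simp [genB])
  exact isQRep_of_forall_relB fun x y hxy => by
    rw [hlift, RingQuot.mkAlgHom_rel KK hxy]

/-- The algebra homomorphism out of the quantum group attached to a family of generators. -/
def IsQRep.liftB (h : IsQRep (datumB n) φ) : UB n →ₐ[KK] A :=
  RingQuot.liftAlgHom KK ⟨FreeAlgebra.lift KK φ, fun _ _ hxy => h.lift_eq_of_relB hxy⟩

theorem IsQRep.liftB_genB (h : IsQRep (datumB n) φ) (g : Gen (n + 1)) :
    h.liftB (genB n g) = φ g := by
  simp [IsQRep.liftB, genB]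

theorem algHom_ext_genB {R : Type*} [Semiring R] [Algebra KK R] {f g : UB n →ₐ[KK] R}
    (h : ∀ x, f (genB n x) = g (genB n x)) : f = g :=
  RingQuot.ringQuot_ext' KK _ _ (FreeAlgebra.hom_ext (funext h))

theorem induction_genB {P : UB n → Prop} (algebraMap : ∀ c, P (algebraMap KK (UB n) c))
    (gen : ∀ g, P (genB n g)) (add : ∀ x y, P x → P y → P (x + y))
    (mul : ∀ x y, P x → P y → P (x * y)) (x : UB n) : P x := by
  obtain ⟨x, rfl⟩ := RingQuot.mkAlgHom_surjective KK (RelB n) x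
  induction x using FreeAlgebra.induction with
  | grade0 c => simpa using algebraMap c
  | grade1 g => exact gen g
  | mul x y hx hy => simpa using mul _ _ hx hy
  | add x y hx hy => simpa using add _ _ hx hy

/-- The comultiplication of the quantum group. -/
def comulB (n : ℕ) : UB n →ₐ[KK] UB n ⊗[KK] UB n := (isQRep_genB n).comulGen.liftB

/-- The counit of the quantum group. -/
def counitB (n : ℕ) : UB n →ₐ[KK] KK :=
  (isQRep_counitGen (D := datumB n)).liftB

/-- The antipode of the quantum group. -/
def antipodeB (n : ℕ) : UB n →ₗ[KK] UB n :=
  (MulOpposite.opLinearEquiv KK).symm.toLinearMap ∘ₗ (isQRep_genB n).antipodeGen.liftB.toLinearMap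

theorem comulB_genB (g : Gen (n + 1)) : comulB n (genB n g) = comulGen KK (genB n) g :=
  (isQRep_genB n).comulGen.liftB_genB g

theorem counitB_genB (g : Gen (n + 1)) : counitB n (genB n g) = counitGen KK g :=
  (isQRep_counitGen (D := datumB n)).liftB_genB g

theorem antipodeB_genB (g : Gen (n + 1)) :
    antipodeB n (genB n g) = (antipodeGen (genB n) g).unop :=
  congrArg MulOpposite.unop ((isQRep_genB n).antipodeGen.liftB_genB g)

theorem antipodeB_one : antipodeB n 1 = 1 := by simp [antipodeB]

theorem antipodeB_mul (x y : UB n) : antipodeB n (x * y) = antipodeB n y * antipodeB n x := by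
  simp [antipodeB]

theorem comulB_coassoc (x : UB n) :
    TensorProduct.assoc KK (UB n) (UB n) (UB n)
        (TensorProduct.map (comulB n).toLinearMap LinearMap.id (comulB n x))
      = TensorProduct.map LinearMap.id (comulB n).toLinearMap (comulB n x) := by
  have : (AlgHom.comp (Algebra.TensorProduct.assoc KK KK KK (UB n) (UB n) (UB n)).toAlgHom
      (Algebra.TensorProduct.map (comulB n) (AlgHom.id KK (UB n)))).comp (comulB n)
      = (Algebra.TensorProduct.map (AlgHom.id KK (UB n)) (comulB n)).comp (comulB n) := by
    refine algHom_ext_genB fun g => ?_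
    cases g <;>
      simp [comulB_genB, comulGen, TensorProduct.add_tmul, TensorProduct.tmul_add, add_assoc,
        Algebra.TensorProduct.one_def]
  exact DFunLike.congr_fun this x

theorem comulB_counit_left (x : UB n) :
    TensorProduct.lid KK (UB n)
      (TensorProduct.map (counitB n).toLinearMap LinearMap.id (comulB n x)) = x := by
  have : (AlgHom.comp (Algebra.TensorProduct.lid KK (UB n)).toAlgHom
      (Algebra.TensorProduct.map (counitB n) (AlgHom.id KK (UB n)))).comp (comulB n)
      = AlgHom.id KK (UB n) := by
    refine algHom_ext_genB fun g => ?_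
    cases g <;> simp [comulB_genB, counitB_genB, comulGen, counitGen]
  exact DFunLike.congr_fun this x

theorem comulB_counit_right (x : UB n) :
    TensorProduct.rid KK (UB n)
      (TensorProduct.map LinearMap.id (counitB n).toLinearMap (comulB n x)) = x := by
  have : (AlgHom.comp (Algebra.TensorProduct.rid KK KK (UB n)).toAlgHom
      (Algebra.TensorProduct.map (AlgHom.id KK (UB n)) (counitB n))).comp (comulB n)
      = AlgHom.id KK (UB n) := by
    refine algHom_ext_genB fun g => ?_
    cases g <;> simp [comulB_genB, counitB_genB, comulGen, counitGen]
  exact DFunLike.congr_fun this x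

section Antipode

variable {K H : Type*} [Field K] [Ring H] [Algebra K H] {S : H →ₗ[K] H}

theorem mul'_map_antipode_mul_left (hS : ∀ x y, S (x * y) = S y * S x) {t : H ⊗[K] H} {c : K}
    (ht : LinearMap.mul' K H (TensorProduct.map S LinearMap.id t) = algebraMap K H c)
    (t' : H ⊗[K] H) :
    LinearMap.mul' K H (TensorProduct.map S LinearMap.id (t * t'))
      = c • LinearMap.mul' K H (TensorProduct.map S LinearMap.id t') := by
  induction t' with
  | zero => simp
  | add u v hu hv => simp only [mul_add, map_add, hu, hv, smul_add]
  | tmul a b =>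
    have key : LinearMap.mul' K H (TensorProduct.map S LinearMap.id (t * a ⊗ₜ b))
        = S a * LinearMap.mul' K H (TensorProduct.map S LinearMap.id t) * b := by
      clear ht
      induction t with
      | zero => simp
      | add u v hu hv => simp only [mul_add, add_mul, map_add, hu, hv]
      | tmul x y => simp [hS, mul_assoc]
    rw [key, ht, ← Algebra.commutes, mul_assoc, ← Algebra.smul_def]
    simp

theorem mul'_map_antipode_mul_right (hS : ∀ x y, S (x * y) = S y * S x) {t' : H ⊗[K] H} {c : K}
    (ht : LinearMap.mul' K H (TensorProduct.map LinearMap.id S t') = algebraMap K H c)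
    (t : H ⊗[K] H) :
    LinearMap.mul' K H (TensorProduct.map LinearMap.id S (t * t'))
      = c • LinearMap.mul' K H (TensorProduct.map LinearMap.id S t) := by
  induction t with
  | zero => simp
  | add u v hu hv => simp only [add_mul, map_add, hu, hv, smul_add]
  | tmul a b =>
    have key : LinearMap.mul' K H (TensorProduct.map LinearMap.id S (a ⊗ₜ b * t'))
        = a * LinearMap.mul' K H (TensorProduct.map LinearMap.id S t') * S b := by
      clear ht
      induction t' with
      | zero => simp
      | add u v hu hv => simp only [mul_add, add_mul, map_add, hu, hv]
      | tmul x y => simp [hS, mul_assoc]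
    rw [key, ht, ← Algebra.commutes, mul_assoc, ← Algebra.smul_def]
    simp

end Antipode

theorem IsQRep.f_add_neg_f_wpinv_mul_wp (h : IsQRep (datumB n) φ) (i : Fin (n + 1)) :
    φ (.f i) + -(φ (.f i) * φ (.wpinv i)) * φ (.wp i) = 0 := by
  rw [neg_mul, mul_assoc, h.wpinv_wp, mul_one, add_neg_cancel]

theorem IsQRep.e_add_w_mul_neg_winv_e (h : IsQRep (datumB n) φ) (i : Fin (n + 1)) :
    φ (.e i) + φ (.w i) * -(φ (.winv i) * φ (.e i)) = 0 := by
  rw [mul_neg, ← mul_assoc, h.w_winv, one_mul, add_neg_cancel]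

theorem antipodeB_left (x : UB n) :
    LinearMap.mul' KK (UB n) (TensorProduct.map (antipodeB n) LinearMap.id (comulB n x))
      = algebraMap KK (UB n) (counitB n x) := by
  have h := isQRep_genB n
  induction x using induction_genB with
  | algebraMap c =>
    simp [Algebra.algebraMap_eq_smul_one, Algebra.TensorProduct.one_def, antipodeB_one]
  | add x y hx hy => simp only [map_add, hx, hy]
  | mul x y hx hy =>
    rw [map_mul, mul'_map_antipode_mul_left antipodeB_mul hx, hy, map_mul, map_mul,
      Algebra.smul_def]
  | gen g =>
    cases g <;> simp [comulB_genB, counitB_genB, antipodeB_genB, comulGen, counitGen, antipodeGen,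
      antipodeB_one, h.w_winv, h.winv_w, h.wp_wpinv, h.wpinv_wp]
    case f i => exact h.f_add_neg_f_wpinv_mul_wp i

theorem antipodeB_right (x : UB n) :
    LinearMap.mul' KK (UB n) (TensorProduct.map LinearMap.id (antipodeB n) (comulB n x))
      = algebraMap KK (UB n) (counitB n x) := by
  have h := isQRep_genB n
  induction x using induction_genB with
  | algebraMap c =>
    simp [Algebra.algebraMap_eq_smul_one, Algebra.TensorProduct.one_def, antipodeB_one]
  | add x y hx hy => simp only [map_add, hx, hy]
  | mul x y hx hy =>
    rw [map_mul, mul'_map_antipode_mul_right antipodeB_mul hy, hx, map_mul, map_mul,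
      ← Algebra.commutes, Algebra.smul_def]
  | gen g =>
    cases g <;> simp [comulB_genB, counitB_genB, antipodeB_genB, comulGen, counitGen, antipodeGen,
      antipodeB_one, h.w_winv, h.winv_w, h.wp_wpinv, h.wpinv_wp]
    case e i => exact h.e_add_w_mul_neg_winv_e i

end TypeB

theorem stmt0 (n : ℕ) :
    ∃ (Δ : UB n →ₐ[KK] (UB n ⊗[KK] UB n)) (ε : UB n →ₐ[KK] KK) (S : UB n →ₗ[KK] UB n),
      -- values of Δ on generators
      (∀ i : Fin (n+1),
        Δ (genB n (.w i)) = genB n (.w i) ⊗ₜ[KK] genB n (.w i) ∧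
        Δ (genB n (.winv i)) = genB n (.winv i) ⊗ₜ[KK] genB n (.winv i) ∧
        Δ (genB n (.wp i)) = genB n (.wp i) ⊗ₜ[KK] genB n (.wp i) ∧
        Δ (genB n (.wpinv i)) = genB n (.wpinv i) ⊗ₜ[KK] genB n (.wpinv i) ∧
        Δ (genB n (.e i)) = genB n (.e i) ⊗ₜ[KK] 1 + genB n (.w i) ⊗ₜ[KK] genB n (.e i) ∧
        Δ (genB n (.f i)) = 1 ⊗ₜ[KK] genB n (.f i) + genB n (.f i) ⊗ₜ[KK] genB n (.wp i)) ∧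
      -- values of ε on generators
      (∀ i : Fin (n+1),
        ε (genB n (.w i)) = 1 ∧ ε (genB n (.winv i)) = 1 ∧
        ε (genB n (.wp i)) = 1 ∧ ε (genB n (.wpinv i)) = 1 ∧
        ε (genB n (.e i)) = 0 ∧ ε (genB n (.f i)) = 0) ∧
      -- S is an algebra antihomomorphism with the prescribed generator values
      S 1 = 1 ∧ (∀ x y, S (x * y) = S y * S x) ∧
      (∀ i : Fin (n+1),
        S (genB n (.w i)) = genB n (.winv i) ∧ S (genB n (.winv i)) = genB n (.w i) ∧
        S (genB n (.wp i)) = genB n (.wpinv i) ∧ S (genB n (.wpinv i)) = genB n (.wp i) ∧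
        S (genB n (.e i)) = -(genB n (.winv i) * genB n (.e i)) ∧
        S (genB n (.f i)) = -(genB n (.f i) * genB n (.wpinv i))) ∧
      -- coassociativity
      (∀ x, (TensorProduct.assoc KK (UB n) (UB n) (UB n))
          ((TensorProduct.map Δ.toLinearMap LinearMap.id) (Δ x))
        = (TensorProduct.map LinearMap.id Δ.toLinearMap) (Δ x)) ∧
      -- counit axioms
      (∀ x, (TensorProduct.lid KK (UB n))
          ((TensorProduct.map ε.toLinearMap LinearMap.id) (Δ x)) = x) ∧
      (∀ x, (TensorProduct.rid KK (UB n))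
          ((TensorProduct.map LinearMap.id ε.toLinearMap) (Δ x)) = x) ∧
      -- antipode axioms
      (∀ x, (LinearMap.mul' KK (UB n)) ((TensorProduct.map S LinearMap.id) (Δ x))
        = algebraMap KK (UB n) (ε x)) ∧
      (∀ x, (LinearMap.mul' KK (UB n)) ((TensorProduct.map LinearMap.id S) (Δ x))
        = algebraMap KK (UB n) (ε x)) := by
  refine ⟨comulB n, counitB n, antipodeB n, fun i => ⟨?_, ?_, ?_, ?_, ?_, ?_⟩,
    fun i => ⟨?_, ?_, ?_, ?_, ?_, ?_⟩, antipodeB_one, antipodeB_mul,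
    fun i => ⟨?_, ?_, ?_, ?_, ?_, ?_⟩, comulB_coassoc, comulB_counit_left, comulB_counit_right,
    antipodeB_left, antipodeB_right⟩ <;>
  first | exact comulB_genB _ | exact counitB_genB _ | exact antipodeB_genB _

end
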